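/- Let λ = (l, l−1, …, 2, 1) be the staircase partition and μ ⊆ λ. Then the skew Schur function of λ/μ equals the skew Schur function of its conjugate: s_{λ/μ} = s_{(λ/μ)'} = s_{λ/μ'}. -/

import Mathlib

open YoungDiagram
open scoped Classical

namespace LRSkew

/-- The cells of the skew diagram `lam/mu`. -/
def skewCells (lam mu : YoungDiagram) : Finset (ℕ × ℕ) := lam.cells \ mu.cells

/-- A semistandard filling of the skew shape `lam/mu`: entries are positive exactly on the
cells of the shape, rows are weakly increasing and columns are strictly increasing. -/
def IsSSYT (lam mu : YoungDiagram) (T : ℕ × ℕ → ℕ) : Prop :=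
  (∀ p, p ∈ skewCells lam mu ↔ T p ≠ 0) ∧
  (∀ i j1 j2, (i, j1) ∈ skewCells lam mu → (i, j2) ∈ skewCells lam mu → j1 ≤ j2 →
    T (i, j1) ≤ T (i, j2)) ∧
  (∀ i1 i2 j, (i1, j) ∈ skewCells lam mu → (i2, j) ∈ skewCells lam mu → i1 < i2 →
    T (i1, j) < T (i2, j))

/-- The number of entries equal to `k` among the cells read (in the reverse reading word:
right to left along rows, top row first) up to position `(i,j)`. -/
def prefixCount (lam mu : YoungDiagram) (T : ℕ × ℕ → ℕ) (i j k : ℕ) : ℕ :=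
  ((skewCells lam mu).filter fun p => (p.1 < i ∨ (p.1 = i ∧ j ≤ p.2)) ∧ T p = k).card

/-- The reverse reading word of the filling is a lattice word. -/
def IsLattice (lam mu : YoungDiagram) (T : ℕ × ℕ → ℕ) : Prop :=
  ∀ i j k, prefixCount lam mu T i j (k + 2) ≤ prefixCount lam mu T i j (k + 1)

/-- The number of entries of the filling equal to `k`. -/
def content (lam mu : YoungDiagram) (T : ℕ × ℕ → ℕ) (k : ℕ) : ℕ :=
  ((skewCells lam mu).filter fun p => T p = k).card

/-- A Littlewood–Richardson tableau of shape `lam/mu` and content `nu`. -/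
def IsLR (lam mu nu : YoungDiagram) (T : ℕ × ℕ → ℕ) : Prop :=
  IsSSYT lam mu T ∧ IsLattice lam mu T ∧ ∀ i, content lam mu T (i + 1) = nu.rowLen i

/-- The Littlewood–Richardson coefficient `c(lam; mu, nu)`. -/
noncomputable def lrCoeff (lam mu nu : YoungDiagram) : ℕ :=
  if mu ≤ lam then {T : ℕ × ℕ → ℕ | IsLR lam mu nu T}.ncard else 0

/-- Equality of the skew Schur functions `s_{lam/mu} = s_{alp/bet}`, expressed through
their expansions into Schur functions. -/
def SchurEq (lam mu alp bet : YoungDiagram) : Prop :=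
  ∀ nu : YoungDiagram, lrCoeff lam mu nu = lrCoeff alp bet nu

/-- The rectangular Young diagram `(k^l)` with `l` rows of length `k`. -/
def rect (k l : ℕ) : YoungDiagram :=
  ⟨Finset.range l ×ˢ Finset.range k, by
    intro a b hba ha
    simp only [Finset.coe_product, Set.mem_prod, Finset.mem_coe, Finset.mem_range] at ha ⊢
    exact ⟨lt_of_le_of_lt hba.1 ha.1, lt_of_le_of_lt hba.2 ha.2⟩⟩

/-- The complement of `nu` in the rectangle `(k^l)`, rotated by 180 degrees so that it is
again a partition: its parts are `(k - nu_l, …, k - nu_1)`. -/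
def complRect (k l : ℕ) (nu : YoungDiagram) : YoungDiagram :=
  ⟨(rect k l).cells.filter fun p => (l - 1 - p.1, k - 1 - p.2) ∉ nu, by
    intro a b hba ha
    simp only [Finset.coe_filter, Set.mem_setOf_eq, mem_cells] at ha ⊢
    refine ⟨(rect k l).isLowerSet hba ha.1, fun hmem => ha.2 ?_⟩
    exact nu.isLowerSet
      (Prod.mk_le_mk.mpr ⟨Nat.sub_le_sub_left hba.1 _, Nat.sub_le_sub_left hba.2 _⟩) hmem⟩

/-- The staircase partition `(n, n-1, …, 2, 1)`. -/
def staircase (n : ℕ) : YoungDiagram :=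
  ⟨(Finset.range n ×ˢ Finset.range n).filter fun p => p.1 + p.2 < n, by
    intro a b hba ha
    simp only [Finset.coe_filter, Set.mem_setOf_eq, Finset.mem_product, Finset.mem_range] at ha ⊢
    exact ⟨⟨lt_of_le_of_lt hba.1 ha.1.1, lt_of_le_of_lt hba.2 ha.1.2⟩,
      lt_of_le_of_lt (Nat.add_le_add hba.1 hba.2) ha.2⟩⟩

/-- A basic skew diagram: no empty rows and no empty columns. -/
def IsBasic (lam mu : YoungDiagram) : Prop :=
  (∀ i, i < lam.colLen 0 → mu.rowLen i < lam.rowLen i) ∧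
  (∀ j, j < lam.rowLen 0 → mu.colLen j < lam.colLen j)

/-- A (basic) skew diagram is connected iff consecutive rows share a column. -/
def IsConnectedSkew (lam mu : YoungDiagram) : Prop :=
  ∀ i, i + 1 < lam.colLen 0 → mu.rowLen i < lam.rowLen (i + 1)

/-- The number of distinct (positive) part sizes of a partition. -/
def dp (lam : YoungDiagram) : ℕ :=
  ((Finset.range (lam.colLen 0)).image fun i => lam.rowLen i).card

/-- A partition is a rectangle: all its parts are equal. -/
def IsRect (mu : YoungDiagram) : Prop :=
  ∀ i, i < mu.colLen 0 → mu.rowLen i = mu.rowLen 0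

/-- Cells of a skew diagram in the same connected component: the reflexive–transitive
closure of sharing a row or a column. -/
def SameComp (s : Finset (ℕ × ℕ)) : ℕ × ℕ → ℕ × ℕ → Prop :=
  Relation.ReflTransGen fun a b => a ∈ s ∧ b ∈ s ∧ (a.1 = b.1 ∨ a.2 = b.2)

/-- Two finite sets of boxes agree up to translation or 180°-rotation of each connected
component independently. -/
def UpToTransRot (s t : Finset (ℕ × ℕ)) : Prop :=
  ∃ f : ℕ × ℕ → ℕ × ℕ, Set.BijOn f ↑s ↑t ∧
    ∀ p ∈ s, ∀ q ∈ s, SameComp s p q →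
      (((f q).1 : ℤ) - (f p).1 = (q.1 : ℤ) - p.1 ∧ ((f q).2 : ℤ) - (f p).2 = (q.2 : ℤ) - p.2) ∨
      (((f q).1 : ℤ) - (f p).1 = (p.1 : ℤ) - q.1 ∧ ((f q).2 : ℤ) - (f p).2 = (p.2 : ℤ) - q.2)



/-- `lam/mu` is a horizontal strip. -/
def HS (lam mu : YoungDiagram) : Prop :=
  ∀ r, mu.rowLen r ≤ lam.rowLen r ∧ lam.rowLen (r + 1) ≤ mu.rowLen r

/-- `lam/mu` is a vertical strip. -/
def VS (lam mu : YoungDiagram) : Prop :=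
  ∀ r, mu.rowLen r ≤ lam.rowLen r ∧ lam.rowLen r ≤ mu.rowLen r + 1

lemma le_iff_rowLen (a b : YoungDiagram) : a ≤ b ↔ ∀ r, a.rowLen r ≤ b.rowLen r := by
  constructor
  · intro h r
    by_contra hc
    push Not at hc
    have h1 : (r, b.rowLen r) ∈ a := YoungDiagram.mem_iff_lt_rowLen.2 hc
    have h2 := YoungDiagram.mem_iff_lt_rowLen.1 (h h1)
    omega
  · intro h p hp
    obtain ⟨i, j⟩ := p
    have hp' : (i, j) ∈ a := hp
    have := YoungDiagram.mem_iff_lt_rowLen.1 hp'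
    exact YoungDiagram.mem_iff_lt_rowLen.2 (lt_of_lt_of_le this (h i))

lemma eq_of_rowLen {a b : YoungDiagram} (h : ∀ r, a.rowLen r = b.rowLen r) : a = b :=
  le_antisymm ((le_iff_rowLen a b).2 fun r => (h r).le) ((le_iff_rowLen b a).2 fun r => (h r).ge)

lemma exists_diag (lam : YoungDiagram) (f : ℕ → ℕ) (hf : ∀ r, f (r + 1) ≤ f r)
    (hl : ∀ r, f r ≤ lam.rowLen r) : ∃ D : YoungDiagram, ∀ r, D.rowLen r = f r := by
  have hanti : Antitone f := antitone_nat_of_succ_le hf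
  let D : YoungDiagram := ⟨lam.cells.filter fun p => p.2 < f p.1, by
    intro a b hba ha
    simp only [Finset.coe_filter, Set.mem_setOf_eq, mem_cells] at ha ⊢
    exact ⟨lam.isLowerSet hba ha.1, lt_of_le_of_lt hba.2 (lt_of_lt_of_le ha.2 (hanti hba.1))⟩⟩
  have hD : ∀ i j, (i, j) ∈ D ↔ j < f i := by
    intro i j
    rw [← mem_cells]
    simp only [D, Finset.mem_filter, mem_cells, YoungDiagram.mem_iff_lt_rowLen]
    have := hl i
    omega
  refine ⟨D, fun r => ?_⟩
  have h1 := fun j => (YoungDiagram.mem_iff_lt_rowLen (μ := D) (i := r) (j := j)).symm.trans (hD r j)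
  have h2 := h1 (f r)
  have h3 := h1 (D.rowLen r)
  omega

lemma mem_staircase (n i j : ℕ) : (i, j) ∈ staircase n ↔ i + j < n := by
  rw [← mem_cells]
  simp only [staircase, Finset.mem_filter, Finset.mem_product, Finset.mem_range]
  omega

lemma rowLen_staircase (n r : ℕ) : (staircase n).rowLen r = n - r := by
  have h1 := fun j => (YoungDiagram.mem_iff_lt_rowLen (μ := staircase n) (i := r) (j := j)).symm.trans
    (mem_staircase n r j)
  have h2 := h1 (n - r)
  have h3 := h1 ((staircase n).rowLen r)
  omega

lemma transpose_staircase (n : ℕ) : (staircase n).transpose = staircase n := by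
  ext ⟨i, j⟩
  simp only [mem_cells, YoungDiagram.mem_transpose, Prod.swap_prod_mk, mem_staircase]
  omega

lemma HS_iff (lam mu : YoungDiagram) :
    HS lam mu ↔ (mu ≤ lam ∧ ∀ i j, (i + 1, j) ∈ lam → (i, j) ∈ mu) := by
  rw [le_iff_rowLen]
  simp only [HS, YoungDiagram.mem_iff_lt_rowLen]
  constructor
  · intro h
    exact ⟨fun r => (h r).1, fun i j hj => lt_of_lt_of_le hj (h i).2⟩
  · rintro ⟨h1, h2⟩ r
    refine ⟨h1 r, ?_⟩
    by_contra hc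
    push Not at hc
    exact lt_irrefl _ (h2 r _ hc)

lemma VS_iff (lam mu : YoungDiagram) :
    VS lam mu ↔ (mu ≤ lam ∧ ∀ i j, (i, j + 1) ∈ lam → (i, j) ∈ mu) := by
  rw [le_iff_rowLen]
  simp only [VS, YoungDiagram.mem_iff_lt_rowLen]
  constructor
  · intro h
    refine ⟨fun r => (h r).1, fun i j hj => ?_⟩
    have := (h i).2
    omega
  · rintro ⟨h1, h2⟩ r
    refine ⟨h1 r, ?_⟩
    by_contra hc
    push Not at hc
    exact lt_irrefl _ (h2 r _ hc)

lemma HS_transpose (lam mu : YoungDiagram) : HS lam.transpose mu.transpose ↔ VS lam mu := by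
  rw [HS_iff, VS_iff, YoungDiagram.transpose_le_iff]
  simp only [YoungDiagram.mem_transpose, Prod.swap_prod_mk]
  exact and_congr_right fun _ => ⟨fun h i j => h j i, fun h i j => h j i⟩

lemma card_rows (D : YoungDiagram) (i : ℕ) :
    (D.cells.filter fun p => p.1 < i).card = ∑ r ∈ Finset.range i, D.rowLen r := by
  induction i with
  | zero => simp
  | succ i ih =>
    rw [Finset.sum_range_succ, ← ih, YoungDiagram.rowLen_eq_card, ← Finset.card_union_of_disjoint]
    · congr 1
      ext p
      simp only [Finset.mem_filter, Finset.mem_union, YoungDiagram.row, mem_cells]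
      constructor
      · rintro ⟨h1, h2⟩
        by_cases h : p.1 < i
        · exact Or.inl ⟨h1, h⟩
        · exact Or.inr ⟨h1, by omega⟩
      · rintro (⟨h1, h2⟩ | ⟨h1, h2⟩)
        · exact ⟨h1, by omega⟩
        · exact ⟨h1, by omega⟩
    · rw [Finset.disjoint_left]
      intro p hp hq
      simp only [Finset.mem_filter, YoungDiagram.row] at hp hq
      omega

lemma card_eq_sum {n : ℕ} {D : YoungDiagram} (hD : D ≤ staircase n) :
    D.card = ∑ r ∈ Finset.range n, D.rowLen r := by
  rw [← card_rows, YoungDiagram.card, Finset.filter_true_of_mem]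
  rintro ⟨i, j⟩ hp
  have := (mem_staircase n i j).1 (hD hp)
  simp only
  omega

/-- Toggle of the middle row function `M` between `A` and `B`, for rows at least `i`. -/
def tog (A B M : ℕ → ℕ) (i J : ℕ) (r : ℕ) : ℕ :=
  if r < i then M r
  else (if r = i then J else min (B r) (A (r - 1))) + max (B (r + 1)) (A r) - M r

/-- `A ⊆ M ⊆ B` interlace. -/
def Inter (A B M : ℕ → ℕ) : Prop :=
  ∀ r, A r ≤ M r ∧ M (r + 1) ≤ A r ∧ M r ≤ B r ∧ B (r + 1) ≤ M r

lemma tog_spec {A B M : ℕ → ℕ} {i J : ℕ} (h : Inter A B M) (h1 : J ≤ B i) (h2 : M i ≤ J)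
    (h3 : ∀ i', i = i' + 1 → J ≤ A i') :
    Inter A B (tog A B M i J) ∧ tog A B M i J i ≤ J ∧
    (∀ r, r < i → tog A B M i J r = M r) ∧
    (∀ r, tog A B (tog A B M i J) i J r = M r) := by
  have key : ∀ r, i ≤ r → (if r = i then J else min (B r) (A (r - 1))) ≤ B r ∧
      M r ≤ (if r = i then J else min (B r) (A (r - 1))) ∧
      (∀ r', r = r' + 1 → (if r = i then J else min (B r) (A (r - 1))) ≤ A r') ∧
      max (B (r + 1)) (A r) ≤ M r := by
    intro r hr
    have a1 := h r
    refine ⟨?_, ?_, ?_, max_le a1.2.2.2 a1.1⟩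
    · split_ifs with e
      · rw [e]; exact h1
      · exact min_le_left _ _
    · split_ifs with e
      · rw [e]; exact h2
      · obtain ⟨s, rfl⟩ : ∃ s, r = s + 1 := ⟨r - 1, by omega⟩
        exact le_min a1.2.2.1 (h s).2.1
    · intro r' e'
      split_ifs with e
      · exact h3 r' (by omega)
      · subst e'
        exact min_le_right _ _
  have lt : ∀ r, r < i → tog A B M i J r = M r := fun r hr => by simp [tog, hr]
  have ge : ∀ r, i ≤ r → tog A B M i J r =
      (if r = i then J else min (B r) (A (r - 1))) + max (B (r + 1)) (A r) - M r := fun r hr => by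
    rw [tog, if_neg (by omega)]
  refine ⟨?_, ?_, lt, ?_⟩
  · intro r
    have a1 := h r
    have a2 : tog A B M i J (r + 1) ≤ A r := by
      rcases lt_or_ge (r + 1) i with hr | hr
      · rw [lt _ hr]; exact a1.2.1
      · have k := key _ hr
        have k3 := k.2.2.1 r rfl
        rw [ge _ hr]
        omega
    rcases lt_or_ge r i with hr | hr
    · rw [lt _ hr]; exact ⟨a1.1, a2, a1.2.2⟩
    · have k := key _ hr
      have g1 := le_max_left (B (r + 1)) (A r)
      have g2 := le_max_right (B (r + 1)) (A r)
      have e := ge _ hr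
      refine ⟨?_, a2, ?_, ?_⟩ <;> omega
  · have k := key i le_rfl
    have e := ge i le_rfl
    simp only [if_true] at k e
    omega
  · intro r
    rcases lt_or_ge r i with hr | hr
    · rw [tog, if_pos hr, lt _ hr]
    · rw [tog, if_neg (by omega), ge _ hr]
      have k := key _ hr
      omega

lemma tog_sum {A B M : ℕ → ℕ} {i J : ℕ} (h : Inter A B M) (h2 : M i ≤ J)
    (R : ℕ) : ∑ r ∈ Finset.range (R + 1), (tog A B M i J (i + r) + M (i + r)) +
      min (B (i + R + 1)) (A (i + R)) =
      J + ∑ r ∈ Finset.range (R + 1), (A (i + r) + B (i + r + 1)) := by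
  induction R with
  | zero =>
    have := h i
    simp [tog]
    omega
  | succ R ih =>
    rw [Finset.sum_range_succ, Finset.sum_range_succ (n := R + 1)]
    have a1 := h (i + R)
    have a2 := h (i + (R + 1))
    have e : tog A B M i J (i + (R + 1)) = min (B (i + (R + 1))) (A (i + R)) +
       max (B (i + (R + 1) + 1)) (A (i + (R + 1))) - M (i + (R + 1)) := by
      rw [tog, if_neg (by omega), if_neg (by omega)]
      rfl
    simp only [← add_assoc] at *
    omega


/-- Young diagrams inside the staircase. -/
abbrev Sub (n : ℕ) := {D : YoungDiagram // D ≤ staircase n}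

instance finiteSub (n : ℕ) : Finite (Sub n) := by
  refine Finite.of_injective
    (fun D : Sub n => (⟨D.1.cells, Finset.mem_powerset.2 D.2⟩ :
      ((staircase n).cells.powerset : Finset (Finset (ℕ × ℕ))))) ?_
  intro a b h
  have h' : a.1.cells = b.1.cells := congrArg Subtype.val h
  exact Subtype.ext (YoungDiagram.ext h')

noncomputable instance fintypeSub (n : ℕ) : Fintype (Sub n) := Fintype.ofFinite _

/-- Toggled diagram. -/
noncomputable def togD {n : ℕ} (lam mu kap : Sub n) (i J : ℕ) : Sub n :=
  if h : ∃ k' : Sub n, ∀ r, k'.1.rowLen r = tog mu.1.rowLen lam.1.rowLen kap.1.rowLen i J r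
  then h.choose else kap

lemma inter_iff (lam mu kap : YoungDiagram) :
    Inter mu.rowLen lam.rowLen kap.rowLen ↔ HS lam kap ∧ HS kap mu := by
  constructor
  · intro h
    exact ⟨fun r => ⟨(h r).2.2.1, (h r).2.2.2⟩, fun r => ⟨(h r).1, (h r).2.1⟩⟩
  · rintro ⟨h1, h2⟩ r
    exact ⟨(h2 r).1, (h2 r).2, (h1 r).1, (h1 r).2⟩

lemma togD_rowLen {n : ℕ} {lam mu kap : Sub n} {i J : ℕ} (h : HS lam.1 kap.1) (h' : HS kap.1 mu.1)
    (h1 : J ≤ lam.1.rowLen i) (h2 : kap.1.rowLen i ≤ J)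
    (h3 : ∀ i', i = i' + 1 → J ≤ mu.1.rowLen i') :
    (togD lam mu kap i J).1.rowLen = tog mu.1.rowLen lam.1.rowLen kap.1.rowLen i J := by
  have hI := (inter_iff lam.1 mu.1 kap.1).2 ⟨h, h'⟩
  obtain ⟨t1, -, -, -⟩ := tog_spec hI h1 h2 h3
  obtain ⟨D, hD⟩ := exists_diag lam.1 _ (fun r => (t1 r).2.1.trans (t1 r).1)
    (fun r => (t1 r).2.2.1)
  have hle : D ≤ staircase n := by
    refine le_trans ((le_iff_rowLen _ _).2 fun r => ?_) lam.2
    rw [hD]; exact (t1 r).2.2.1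
  have hex : ∃ k' : Sub n, ∀ r, k'.1.rowLen r =
    tog mu.1.rowLen lam.1.rowLen kap.1.rowLen i J r := ⟨⟨D, hle⟩, hD⟩
  rw [togD, dif_pos hex]
  exact funext hex.choose_spec

lemma togD_spec {n : ℕ} {lam mu kap : Sub n} {i J : ℕ} (h : HS lam.1 kap.1) (h' : HS kap.1 mu.1)
    (h1 : J ≤ lam.1.rowLen i) (h2 : kap.1.rowLen i ≤ J)
    (h3 : ∀ i', i = i' + 1 → J ≤ mu.1.rowLen i') :
    HS lam.1 (togD lam mu kap i J).1 ∧ HS (togD lam mu kap i J).1 mu.1 ∧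
    (togD lam mu kap i J).1.rowLen i ≤ J ∧
    (∀ r, r < i → (togD lam mu kap i J).1.rowLen r = kap.1.rowLen r) ∧
    togD lam mu (togD lam mu kap i J) i J = kap := by
  have hI := (inter_iff lam.1 mu.1 kap.1).2 ⟨h, h'⟩
  obtain ⟨t1, t2, t3, t4⟩ := tog_spec hI h1 h2 h3
  have e := togD_rowLen h h' h1 h2 h3
  rw [← e] at t1 t2 t3 t4
  have g := (inter_iff _ _ _).1 t1
  refine ⟨g.1, g.2, t2, t3, ?_⟩
  apply Subtype.ext
  apply eq_of_rowLen
  rw [togD_rowLen g.1 g.2 h1 t2 h3]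
  exact t4

lemma rowLen_zero {n : ℕ} (D : Sub n) {r : ℕ} (hr : n ≤ r) : D.1.rowLen r = 0 := by
  have := (le_iff_rowLen _ _).1 D.2 r
  rw [rowLen_staircase] at this
  omega

lemma card_eq_sum' {n : ℕ} (D : Sub n) (m : ℕ) (hm : n ≤ m) :
    D.1.card = ∑ r ∈ Finset.range m, D.1.rowLen r := by
  rw [card_eq_sum D.2]
  refine Finset.sum_subset (fun x hx => ?_) (fun x _ hx => ?_)
  · simp only [Finset.mem_range] at *; omega
  · simp only [Finset.mem_range] at *; exact rowLen_zero D (by omega)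

lemma togD_card {n : ℕ} {lam mu kap : Sub n} {i J : ℕ} (h : HS lam.1 kap.1) (h' : HS kap.1 mu.1)
    (h1 : J ≤ lam.1.rowLen i) (h2 : kap.1.rowLen i ≤ J)
    (h3 : ∀ i', i = i' + 1 → J ≤ mu.1.rowLen i') :
    ((togD lam mu kap i J).1.card : ℤ) + kap.1.card = lam.1.card + mu.1.card
      + J - lam.1.rowLen i +
      ∑ r ∈ Finset.range i, (2 * (kap.1.rowLen r : ℤ) - mu.1.rowLen r - lam.1.rowLen r) := by
  have hI := (inter_iff lam.1 mu.1 kap.1).2 ⟨h, h'⟩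
  have s := tog_sum hI h2 n
  have e := togD_rowLen h h' h1 h2 h3
  rw [← e] at s
  obtain ⟨-, -, -, g, -⟩ := togD_spec h h' h1 h2 h3
  set T := togD lam mu kap i J
  rw [card_eq_sum' T (i + (n + 1)) (by omega), card_eq_sum' kap (i + (n + 1)) (by omega),
    card_eq_sum' lam (i + (n + 1)) (by omega), card_eq_sum' mu (i + (n + 1)) (by omega)]
  simp only [Finset.sum_range_add _ i (n + 1)]
  rw [rowLen_zero lam (r := i + n + 1) (by omega)] at s
  have s2 : ∑ r ∈ Finset.range (n + 1), lam.1.rowLen (i + r + 1) + lam.1.rowLen i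
      = ∑ r ∈ Finset.range (n + 1), lam.1.rowLen (i + r) := by
    have a := Finset.sum_range_succ (fun r => lam.1.rowLen (i + r)) (n + 1)
    have b := Finset.sum_range_succ' (fun r => lam.1.rowLen (i + r)) (n + 1)
    rw [rowLen_zero lam (r := i + (n + 1)) (by omega)] at a
    simp only [← add_assoc, add_zero] at a b
    omega
  have s3 : ∑ r ∈ Finset.range i, T.1.rowLen r = ∑ r ∈ Finset.range i, kap.1.rowLen r :=
    Finset.sum_congr rfl fun r hr => g r (Finset.mem_range.1 hr)
  rw [s3]
  simp only [Finset.sum_add_distrib, Nat.zero_min, add_zero] at s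
  simp only [Finset.sum_sub_distrib, ← Finset.mul_sum]
  zify at s s2
  push_cast
  linarith

section mats
variable {R : Type*} [CommRing R] {n : ℕ}

/-- Horizontal strip matrix. -/
noncomputable def Hm (n : ℕ) (t : R) : Matrix (Sub n) (Sub n) R :=
  Matrix.of fun l m => if HS l.1 m.1 then t ^ (l.1.card - m.1.card) else 0

lemma HS.le {l m : YoungDiagram} (h : HS l m) : m ≤ l := ((HS_iff l m).1 h).1

lemma HS.card_le {l m : YoungDiagram} (h : HS l m) : m.card ≤ l.card :=
  Finset.card_le_card h.le

lemma Hm_comm (s t : R) : Hm n s * Hm n t = Hm n t * Hm n s := by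
  ext lam mu
  have key : ∀ s t : R, (Hm n s * Hm n t) lam mu =
      ∑ kap : Sub n with (HS lam.1 kap.1 ∧ HS kap.1 mu.1),
        s ^ (lam.1.card - kap.1.card) * t ^ (kap.1.card - mu.1.card) := by
    intro s t
    rw [Matrix.mul_apply, Finset.sum_filter]
    refine Finset.sum_congr rfl fun kap _ => ?_
    simp only [Hm, Matrix.of_apply]
    by_cases h1 : HS lam.1 kap.1 <;> by_cases h2 : HS kap.1 mu.1 <;> simp [h1, h2]
  rw [key, key]
  have hh : ∀ kap : Sub n, HS lam.1 kap.1 ∧ HS kap.1 mu.1 → _ := fun kap h =>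
    togD_spec h.1 h.2 (le_refl (lam.1.rowLen 0)) (h.1 0).1 (fun i' hi => by omega)
  refine Finset.sum_bij' (fun kap _ => togD lam mu kap 0 (lam.1.rowLen 0))
    (fun kap _ => togD lam mu kap 0 (lam.1.rowLen 0)) ?_ ?_ ?_ ?_ ?_
  · intro kap hk
    simp only [Finset.mem_filter, Finset.mem_univ, true_and] at hk ⊢
    exact ⟨(hh kap hk).1, (hh kap hk).2.1⟩
  · intro kap hk
    simp only [Finset.mem_filter, Finset.mem_univ, true_and] at hk ⊢
    exact ⟨(hh kap hk).1, (hh kap hk).2.1⟩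
  · intro kap hk
    simp only [Finset.mem_filter, Finset.mem_univ, true_and] at hk
    exact (hh kap hk).2.2.2.2
  · intro kap hk
    simp only [Finset.mem_filter, Finset.mem_univ, true_and] at hk
    exact (hh kap hk).2.2.2.2
  · intro kap hk
    simp only [Finset.mem_filter, Finset.mem_univ, true_and] at hk
    have c := togD_card hk.1 hk.2 (le_refl (lam.1.rowLen 0)) (hk.1 0).1 (fun i' hi => by omega)
    simp only [Finset.range_zero, Finset.sum_empty] at c
    have d1 := hk.1.card_le
    have d2 := hk.2.card_le
    rw [mul_comm]
    congr 2 <;> omega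

/-- Transposition on diagrams inside the staircase. -/
def tr (n : ℕ) : Sub n ≃ Sub n where
  toFun D := ⟨D.1.transpose, (YoungDiagram.transpose_mono D.2).trans (transpose_staircase n).le⟩
  invFun D := ⟨D.1.transpose, (YoungDiagram.transpose_mono D.2).trans (transpose_staircase n).le⟩
  left_inv D := by simp
  right_inv D := by simp

/-- Vertical strip matrix. -/
noncomputable def Em (n : ℕ) (t : R) : Matrix (Sub n) (Sub n) R :=
  (Hm n t).submatrix (tr n) (tr n)

lemma card_transpose (D : YoungDiagram) : D.transpose.card = D.card := by
  simp [YoungDiagram.transpose, YoungDiagram.card]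

lemma Em_apply (t : R) (l m : Sub n) :
    Em n t l m = if VS l.1 m.1 then t ^ (l.1.card - m.1.card) else 0 := by
  simp only [Em, Hm, Matrix.submatrix_apply, Matrix.of_apply, tr, Equiv.coe_fn_mk, HS_transpose,
    card_transpose]

lemma Em_comm (s t : R) : Em n s * Em n t = Em n t * Em n s := by
  rw [Em, Em, Matrix.submatrix_mul_equiv, Hm_comm, ← Matrix.submatrix_mul_equiv _ _ _ (tr n)]

lemma HS_refl (D : YoungDiagram) : HS D D :=
  fun r => ⟨le_rfl, D.rowLen_anti _ _ (Nat.le_succ r)⟩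

lemma VS_refl (D : YoungDiagram) : VS D D := fun _ => ⟨le_rfl, Nat.le_succ _⟩

lemma Hm_mul_Em (t : R) : Hm n t * Em n (-t) = 1 := by
  ext lam mu
  have key : (Hm n t * Em n (-t)) lam mu =
      ∑ kap : Sub n with (HS lam.1 kap.1 ∧ VS kap.1 mu.1),
        t ^ (lam.1.card - kap.1.card) * (-t) ^ (kap.1.card - mu.1.card) := by
    rw [Matrix.mul_apply, Finset.sum_filter]
    refine Finset.sum_congr rfl fun kap _ => ?_
    rw [Em_apply]
    simp only [Hm, Matrix.of_apply]
    by_cases h1 : HS lam.1 kap.1 <;> by_cases h2 : VS kap.1 mu.1 <;> simp [h1, h2]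
  rw [key]
  by_cases hlm : lam = mu
  · subst hlm
    rw [Finset.sum_eq_single lam]
    · simp
    · intro b hb hne
      exfalso
      simp only [Finset.mem_filter, Finset.mem_univ, true_and] at hb
      exact hne (Subtype.ext (le_antisymm hb.1.le ((VS_iff _ _).1 hb.2).1))
    · intro h
      exact absurd (by simp [HS_refl, VS_refl]) h
  · rw [Matrix.one_apply_ne hlm]
    by_cases hle : ∀ r, mu.1.rowLen r ≤ lam.1.rowLen r
    swap
    · apply Finset.sum_eq_zero
      intro kap hk
      simp only [Finset.mem_filter, Finset.mem_univ, true_and] at hk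
      exact absurd (fun r => ((hk.2 r).1.trans (hk.1 r).1)) hle
    -- the last row where the two differ
    obtain ⟨r0, hr0, hr1⟩ : ∃ r0, mu.1.rowLen r0 < lam.1.rowLen r0 ∧
        ∀ r, r0 < r → lam.1.rowLen r = mu.1.rowLen r := by
      have hex : ∃ r, r ≤ n ∧ mu.1.rowLen r < lam.1.rowLen r := by
        by_contra hc
        push Not at hc
        apply hlm
        apply Subtype.ext
        apply eq_of_rowLen
        intro r
        rcases le_total r n with h | h
        · exact le_antisymm (hc r h) (hle r)
        · rw [rowLen_zero _ h, rowLen_zero _ h]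
      obtain ⟨r, hr, hrr⟩ := hex
      refine ⟨Nat.findGreatest (fun r => mu.1.rowLen r < lam.1.rowLen r) n,
        Nat.findGreatest_spec (P := fun r => mu.1.rowLen r < lam.1.rowLen r) hr hrr, fun s hs => ?_⟩
      rcases le_total s n with h | h
      · have := Nat.findGreatest_is_greatest hs h
        exact le_antisymm (not_lt.1 this) (hle s)
      · rw [rowLen_zero _ h, rowLen_zero _ h]
    have hr2 := hr1 (r0 + 1) (by omega)
    have hmm := mu.1.rowLen_anti r0 (r0 + 1) (by omega)
    have hex : ∀ kap : Sub n, HS lam.1 kap.1 ∧ VS kap.1 mu.1 → ∃ k' : Sub n, ∀ r,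
        k'.1.rowLen r = if r = r0 then 2 * mu.1.rowLen r0 + 1 - kap.1.rowLen r0
          else kap.1.rowLen r := by
      rintro kap ⟨h1, h2⟩
      have v0 := h2 r0
      obtain ⟨D, hD⟩ := exists_diag lam.1 (fun r => if r = r0 then
          2 * mu.1.rowLen r0 + 1 - kap.1.rowLen r0 else kap.1.rowLen r) (by
        intro r
        have b1 := h1 r
        have b2 := h1 (r + 1)
        have v1 := h2 r
        have v2 := h2 (r + 1)
        split_ifs with e1 e2 e2
        · omega
        · subst e1; omega
        · subst e2; omega
        · omega) (by
        intro r
        have b1 := h1 r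
        split_ifs with e1
        · subst e1; omega
        · exact b1.1)
      refine ⟨⟨D, le_trans ((le_iff_rowLen _ _).2 fun r => ?_) lam.2⟩, hD⟩
      rw [hD]
      have b1 := h1 r
      split_ifs with e1
      · subst e1; omega
      · exact b1.1
    refine Finset.sum_involution
      (fun kap hk => (hex kap (by simpa using hk)).choose) ?_ ?_ ?_ ?_
    · intro kap hk
      have sp := (hex kap (by simpa using hk)).choose_spec
      set k' := (hex kap (by simpa using hk)).choose
      simp only [Finset.mem_filter, Finset.mem_univ, true_and] at hk
      obtain ⟨h1, h2⟩ := hk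
      have v0 := h2 r0
      have hc1 : kap.1.card ≤ lam.1.card := h1.card_le
      have hc2 : mu.1.card ≤ kap.1.card := Finset.card_le_card ((VS_iff _ _).1 h2).1
      have hr0n : r0 ∈ Finset.range (n + r0 + 1) := by simp
      have cc : ((k'.1.card : ℤ)) - kap.1.card = 2 * mu.1.rowLen r0 + 1 - 2 * kap.1.rowLen r0 := by
        rw [card_eq_sum' k' (n + r0 + 1) (by omega), card_eq_sum' kap (n + r0 + 1) (by omega)]
        push_cast
        rw [← Finset.sum_sub_distrib, Finset.sum_eq_single r0]
        · rw [sp, if_pos rfl]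
          omega
        · intro r _ hr
          rw [sp, if_neg hr]; simp
        · intro h; exact absurd hr0n h
      have hc3 : k'.1.card ≤ lam.1.card := Finset.card_le_card ((le_iff_rowLen _ _).2 (by
        intro r
        rw [sp]
        split_ifs with e1
        · subst e1; omega
        · exact (h1 r).1))
      have hc4 : mu.1.card ≤ k'.1.card := Finset.card_le_card ((le_iff_rowLen _ _).2 (by
        intro r
        rw [sp]
        split_ifs with e1
        · subst e1; omega
        · exact (h2 r).1))
      have : k'.1.card = kap.1.card + 1 ∨ kap.1.card = k'.1.card + 1 := by omega
      rcases this with e | e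
      · obtain ⟨a, ha⟩ := Nat.exists_eq_add_of_le hc2
        obtain ⟨b, hb⟩ := Nat.exists_eq_add_of_le hc3
        have i1 : lam.1.card - kap.1.card = b + 1 := by omega
        have i2 : kap.1.card - mu.1.card = a := by omega
        have i3 : lam.1.card - k'.1.card = b := by omega
        have i4 : k'.1.card - mu.1.card = a + 1 := by omega
        rw [i1, i2, i3, i4]; ring
      · obtain ⟨a, ha⟩ := Nat.exists_eq_add_of_le hc4
        obtain ⟨b, hb⟩ := Nat.exists_eq_add_of_le hc1
        have i1 : lam.1.card - kap.1.card = b := by omega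
        have i2 : kap.1.card - mu.1.card = a + 1 := by omega
        have i3 : lam.1.card - k'.1.card = b + 1 := by omega
        have i4 : k'.1.card - mu.1.card = a := by omega
        rw [i1, i2, i3, i4]; ring
    · intro kap hk _ he
      have sp := (hex kap (by simpa using hk)).choose_spec
      rw [he] at sp
      have := sp r0
      simp only [Finset.mem_filter, Finset.mem_univ, true_and] at hk
      have v0 := hk.2 r0
      rw [if_pos rfl] at this
      omega
    · intro kap hk
      have sp := (hex kap (by simpa using hk)).choose_spec
      set k' := (hex kap (by simpa using hk)).choose
      simp only [Finset.mem_filter, Finset.mem_univ, true_and] at hk ⊢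
      obtain ⟨h1, h2⟩ := hk
      have v0 := h2 r0
      constructor
      · intro r
        have := h1 r
        rw [sp]
        split_ifs with e1
        · subst e1; omega
        · exact this
      · intro r
        have := h2 r
        rw [sp]
        split_ifs with e1
        · subst e1; omega
        · exact this
    · intro kap hk
      have sp := (hex kap (by simpa using hk)).choose_spec
      generalize_proofs p1 p2
      have sp2 := p2.choose_spec
      apply Subtype.ext
      apply eq_of_rowLen
      intro r
      have sp0 := sp r0
      rw [sp2]
      have spr := sp r
      simp only [Finset.mem_filter, Finset.mem_univ, true_and] at hk
      have v0 := hk.2 r0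
      rw [if_pos rfl] at sp0
      split_ifs with e1
      · subst e1; omega
      · rw [if_neg e1] at spr; exact spr

lemma Em_Hm_comm (s t : R) : Em n s * Hm n t = Hm n t * Em n s := by
  have h1 : Hm n (-s) * Em n s = 1 := by simpa using Hm_mul_Em (n := n) (-s)
  have h2 : Em n s * Hm n (-s) = 1 := mul_eq_one_comm.1 h1
  calc Em n s * Hm n t = Em n s * Hm n t * (Hm n (-s) * Em n s) := by rw [h1, mul_one]
    _ = Em n s * (Hm n t * Hm n (-s)) * Em n s := by simp only [mul_assoc]
    _ = (Em n s * Hm n (-s)) * (Hm n t * Em n s) := by rw [Hm_comm]; simp only [mul_assoc]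
    _ = _ := by rw [h2, one_mul]

/-- The staircase as an element. -/
def top (n : ℕ) : Sub n := ⟨staircase n, le_rfl⟩

lemma row_top (t : R) : (Hm n t) (top n) = (Em n t) (top n) := by
  funext m
  rw [Em_apply]
  have : HS (top n).1 m.1 ↔ VS (top n).1 m.1 := by
    simp only [HS, VS, top, rowLen_staircase]
    refine forall_congr' fun r => ?_
    omega
  simp only [Hm, Matrix.of_apply, this]

lemma row_mul {A B : Matrix (Sub n) (Sub n) R} (C : Matrix (Sub n) (Sub n) R)
    (h : A (top n) = B (top n)) : (A * C) (top n) = (B * C) (top n) := by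
  funext m
  rw [Matrix.mul_apply, Matrix.mul_apply, h]

/-- Product of horizontal strip matrices. -/
noncomputable def HP (n : ℕ) (x : ℕ → R) : ℕ → Matrix (Sub n) (Sub n) R
  | 0 => 1
  | N + 1 => HP n x N * Hm n (x N)

/-- Product of vertical strip matrices. -/
noncomputable def EP (n : ℕ) (x : ℕ → R) : ℕ → Matrix (Sub n) (Sub n) R
  | 0 => 1
  | N + 1 => EP n x N * Em n (x N)

lemma HP_Em_comm (x : ℕ → R) (t : R) (N : ℕ) : HP n x N * Em n t = Em n t * HP n x N := by
  induction N with
  | zero => simp [HP]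
  | succ N ih => rw [HP, mul_assoc, ← Em_Hm_comm, ← mul_assoc, ih, mul_assoc]

lemma HP_Hm_comm (x : ℕ → R) (t : R) (N : ℕ) : HP n x N * Hm n t = Hm n t * HP n x N := by
  induction N with
  | zero => simp [HP]
  | succ N ih => rw [HP, mul_assoc, Hm_comm, ← mul_assoc, ih, mul_assoc]

lemma HP_row (x : ℕ → R) (N : ℕ) : (HP n x N) (top n) = (EP n x N) (top n) := by
  induction N with
  | zero => rfl
  | succ N ih =>
    rw [HP, EP, HP_Hm_comm, row_mul _ (row_top _), ← HP_Em_comm, row_mul _ ih]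

lemma EP_eq (x : ℕ → R) (N : ℕ) : EP n x N = (HP n x N).submatrix (tr n) (tr n) := by
  induction N with
  | zero => simp [EP, HP]
  | succ N ih => rw [EP, HP, ih, Em, Matrix.submatrix_mul_equiv]

lemma HP_transpose (x : ℕ → R) (N : ℕ) (mu : Sub n) :
    HP n x N (top n) (tr n mu) = HP n x N (top n) mu := by
  have h := congrFun (HP_row (n := n) x N) mu
  rw [EP_eq, Matrix.submatrix_apply] at h
  have h2 : tr n (top n) = top n := Subtype.ext (transpose_staircase n)
  rw [h2] at h
  exact h.symm

end mats

/-- Chains of horizontal strips from `mu` to `lam` of length `N`. -/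
def ChSet (n N : ℕ) (lam mu : Sub n) : Set (ℕ → Sub n) :=
  fun C => C 0 = mu ∧ (∀ k, N ≤ k → C k = lam) ∧ ∀ k, HS (C (k + 1)).1 (C k).1

lemma mem_ChSet {n N : ℕ} {lam mu : Sub n} {C : ℕ → Sub n} : C ∈ ChSet n N lam mu ↔
    C 0 = mu ∧ (∀ k, N ≤ k → C k = lam) ∧ ∀ k, HS (C (k + 1)).1 (C k).1 := Iff.rfl

lemma finite_ChSet (n N : ℕ) (lam mu : Sub n) : (ChSet n N lam mu).Finite := by
  refine Set.Finite.of_injOn (f := fun (C : ℕ → Sub n) => fun i : Fin N => C i)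
    (t := Set.univ) (fun _ _ => Set.mem_univ _) ?_ Set.finite_univ
  intro C hC D hD h
  funext k
  rcases lt_or_ge k N with hk | hk
  · exact congrFun h ⟨k, hk⟩
  · rw [hC.2.1 k hk, hD.2.1 k hk]

/-- Chains as a finset. -/
noncomputable def Ch (n N : ℕ) (lam mu : Sub n) : Finset (ℕ → Sub n) :=
  (finite_ChSet n N lam mu).toFinset

lemma mem_Ch {n N : ℕ} {lam mu : Sub n} {C : ℕ → Sub n} : C ∈ Ch n N lam mu ↔
    C 0 = mu ∧ (∀ k, N ≤ k → C k = lam) ∧ ∀ k, HS (C (k + 1)).1 (C k).1 := by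
  rw [Ch, Set.Finite.mem_toFinset, mem_ChSet]

/-- Size of the `k`-th step. -/
def cc {n : ℕ} (C : ℕ → Sub n) (k : ℕ) : ℕ := (C (k + 1)).1.card - (C k).1.card

lemma gen {R : Type*} [CommRing R] {n : ℕ} (x : ℕ → R) (N : ℕ) (lam mu : Sub n) :
    ∑ C ∈ Ch n N lam mu, ∏ k ∈ Finset.range N, x k ^ cc C k = HP n x N lam mu := by
  induction N generalizing lam with
  | zero =>
    rw [HP]
    by_cases h : lam = mu
    · subst h
      have : Ch n 0 lam lam = {fun _ => lam} := by
        ext C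
        rw [mem_Ch, Finset.mem_singleton]
        constructor
        · rintro ⟨-, h, -⟩
          exact funext fun k => h k (Nat.zero_le k)
        · rintro rfl
          exact ⟨rfl, fun _ _ => rfl, fun _ => HS_refl _⟩
      rw [this]
      simp
    · rw [Matrix.one_apply_ne h]
      apply Finset.sum_eq_zero
      intro C hC
      rw [mem_Ch] at hC
      exact absurd ((hC.2.1 0 le_rfl).symm.trans hC.1) h
  | succ N ih =>
    rw [HP, HP_Hm_comm, Matrix.mul_apply]
    have e : ∀ kap : Sub n, Hm n (x N) lam kap * HP n x N kap mu =
        ∑ C ∈ Ch n N kap mu, Hm n (x N) lam kap * ∏ k ∈ Finset.range N, x k ^ cc C k := by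
      intro kap
      rw [← ih, Finset.mul_sum]
    simp only [e]
    have e2 : ∑ kap : Sub n, ∑ C ∈ Ch n N kap mu,
        Hm n (x N) lam kap * ∏ k ∈ Finset.range N, x k ^ cc C k =
        ∑ kap : Sub n with HS lam.1 kap.1, ∑ C ∈ Ch n N kap mu,
        x N ^ (lam.1.card - kap.1.card) * ∏ k ∈ Finset.range N, x k ^ cc C k := by
      rw [Finset.sum_filter]
      refine Finset.sum_congr rfl fun kap _ => ?_
      simp only [Hm, Matrix.of_apply]
      split_ifs with h
      · rfl
      · simp
    rw [e2, Finset.sum_sigma']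
    refine Finset.sum_bij' (fun C _ => ⟨C N, fun k => C (min k N)⟩)
      (fun p _ => fun k => if k ≤ N then p.2 k else lam) ?_ ?_ ?_ ?_ ?_
    · intro C hC
      rw [mem_Ch] at hC
      obtain ⟨h1, h2, h3⟩ := hC
      simp only [Finset.mem_sigma, Finset.mem_filter, Finset.mem_univ, true_and, mem_Ch]
      refine ⟨?_, ?_, ?_, ?_⟩
      · have := h3 N
        rwa [h2 (N + 1) le_rfl] at this
      · simpa using h1
      · intro k hk
        rw [min_eq_right hk]
      · intro k
        rcases lt_or_ge k N with hk | hk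
        · rw [min_eq_left (by omega : k + 1 ≤ N), min_eq_left hk.le]
          exact h3 k
        · rw [min_eq_right (by omega : N ≤ k + 1), min_eq_right hk]
          exact HS_refl _
    · rintro ⟨kap, C⟩ hC
      simp only [Finset.mem_sigma, Finset.mem_filter, Finset.mem_univ, true_and, mem_Ch] at hC
      obtain ⟨h0, h1, h2, h3⟩ := hC
      rw [mem_Ch]
      refine ⟨?_, ?_, ?_⟩
      · simpa using h1
      · intro k hk
        rw [if_neg (by omega)]
      · intro k
        rcases lt_trichotomy k N with hk | hk | hk
        · rw [if_pos (by omega : k + 1 ≤ N), if_pos hk.le]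
          exact h3 k
        · subst hk
          rw [if_neg (by omega : ¬ k + 1 ≤ k), if_pos le_rfl]
          simp only [h2 k le_rfl]
          exact h0
        · rw [if_neg (by omega : ¬ k + 1 ≤ N), if_neg (by omega)]
          exact HS_refl _
    · intro C hC
      rw [mem_Ch] at hC
      obtain ⟨h1, h2, h3⟩ := hC
      funext k
      simp only
      split_ifs with h
      · rw [min_eq_left h]
      · rw [h2 k (by omega)]
    · rintro ⟨kap, C⟩ hC
      simp only [Finset.mem_sigma, Finset.mem_filter, Finset.mem_univ, true_and, mem_Ch] at hC
      obtain ⟨h0, h1, h2, h3⟩ := hC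
      have a : C N = kap := h2 N le_rfl
      have b : (fun k => if min k N ≤ N then C (min k N) else lam) = C := by
        funext k
        rw [if_pos (min_le_right _ _)]
        rcases le_total k N with hk | hk
        · rw [min_eq_left hk]
        · rw [min_eq_right hk, h2 k hk, a]
      simp only [le_refl, if_true]
      rw [b, a]
    · intro C hC
      rw [mem_Ch] at hC
      obtain ⟨h1, h2, h3⟩ := hC
      rw [Finset.prod_range_succ, mul_comm]
      congr 1
      · simp only [cc, h2 (N + 1) le_rfl]
      · refine Finset.prod_congr rfl fun k hk => ?_
        rw [Finset.mem_range] at hk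
        simp only [cc]
        rw [min_eq_left (by omega : k + 1 ≤ N), min_eq_left hk.le]

/-- Content exponent of a chain. -/
noncomputable def cont {n : ℕ} (N : ℕ) (C : ℕ → Sub n) : ℕ →₀ ℕ :=
  ∑ k ∈ Finset.range N, Finsupp.single k (cc C k)

lemma cont_apply {n : ℕ} {N : ℕ} (C : ℕ → Sub n) {k : ℕ} (hk : k < N) : cont N C k = cc C k := by
  rw [cont, Finsupp.finsetSum_apply, Finset.sum_eq_single k]
  · simp
  · intro b _ hb
    simp [hb]
  · intro h
    exact absurd (Finset.mem_range.2 hk) h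

lemma sum_tr {n : ℕ} (N : ℕ) (mu : Sub n) (g : (ℕ →₀ ℕ) → ℤ) :
    ∑ C ∈ Ch n N (top n) (tr n mu), g (cont N C) = ∑ C ∈ Ch n N (top n) mu, g (cont N C) := by
  have key : ∀ mu : Sub n, ∑ C ∈ Ch n N (top n) mu, g (cont N C) =
      (MvPolynomial.basisMonomials ℕ ℤ).constr ℤ g
        (HP n (fun k => (MvPolynomial.X k : MvPolynomial ℕ ℤ)) N (top n) mu) := by
    intro mu
    rw [← gen, map_sum]
    refine Finset.sum_congr rfl fun C _ => ?_
    have : ∏ k ∈ Finset.range N, (MvPolynomial.X k : MvPolynomial ℕ ℤ) ^ cc C k =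
        MvPolynomial.basisMonomials ℕ ℤ (cont N C) := by
      rw [MvPolynomial.coe_basisMonomials, cont]
      beta_reduce
      rw [MvPolynomial.monomial_sum_one]
      refine Finset.prod_congr rfl fun k _ => ?_
      rw [MvPolynomial.X_pow_eq_monomial]
    rw [this, Module.Basis.constr_basis]
  rw [key, key, HP_transpose]

/-- Failure of the lattice condition in row `i` for the letters `k+1`, `k+2`. -/
def Fail {n : ℕ} (C : ℕ → Sub n) (i k : ℕ) : Prop :=
  ∑ r ∈ Finset.range i, (((C (k + 1)).1.rowLen r : ℤ) - (C k).1.rowLen r) <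
  ∑ r ∈ Finset.range (i + 1), (((C (k + 2)).1.rowLen r : ℤ) - (C (k + 1)).1.rowLen r)

/-- The column of the first failure. -/
def Jz {n : ℕ} (C : ℕ → Sub n) (i k : ℕ) : ℤ :=
  (C (k + 2)).1.rowLen i - 1 - ∑ r ∈ Finset.range i,
    (2 * ((C (k + 1)).1.rowLen r : ℤ) - (C k).1.rowLen r - (C (k + 2)).1.rowLen r)

lemma Jz_def {n : ℕ} (C : ℕ → Sub n) (i k : ℕ) : Jz C i k =
  (C (k + 2)).1.rowLen i - 1 - ∑ r ∈ Finset.range i,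
    (2 * ((C (k + 1)).1.rowLen r : ℤ) - (C k).1.rowLen r - (C (k + 2)).1.rowLen r) := rfl

lemma fail_iff {n : ℕ} (C : ℕ → Sub n) (i k : ℕ) :
    Fail C i k ↔ ((C (k + 1)).1.rowLen i : ℤ) ≤ Jz C i k := by
  rw [Fail, Jz, Finset.sum_range_succ]
  simp only [Finset.sum_sub_distrib, ← Finset.mul_sum]
  constructor <;> intro h <;> linarith

/-- The selected failure: first row, then largest letter. -/
def Sel {n : ℕ} (C : ℕ → Sub n) (i k : ℕ) : Prop :=
  Fail C i k ∧ (∀ i' < i, ∀ k', ¬ Fail C i' k') ∧ ∀ k', k < k' → ¬ Fail C i k'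

lemma Sel.unique {n : ℕ} {C : ℕ → Sub n} {i k i' k' : ℕ} (h : Sel C i k) (h' : Sel C i' k') :
    i = i' ∧ k = k' := by
  have hi : i = i' := by
    rcases lt_trichotomy i i' with g | g | g
    · exact absurd h.1 (h'.2.1 _ g _)
    · exact g
    · exact absurd h'.1 (h.2.1 _ g _)
  subst hi
  refine ⟨rfl, ?_⟩
  rcases lt_trichotomy k k' with g | g | g
  · exact absurd h'.1 (h.2.2 _ g)
  · exact g
  · exact absurd h.1 (h'.2.2 _ g)

lemma fail_lt {n N : ℕ} {lam mu : Sub n} {C : ℕ → Sub n} (hC : C ∈ Ch n N lam mu) {i k : ℕ}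
    (h : Fail C i k) : k + 1 < N := by
  rw [mem_Ch] at hC
  by_contra hc
  push Not at hc
  rw [Fail, hC.2.1 (k + 2) (by omega), hC.2.1 (k + 1) (by omega)] at h
  simp only [sub_self, Finset.sum_const_zero] at h
  have : 0 ≤ ∑ r ∈ Finset.range i, ((lam.1.rowLen r : ℤ) - (C k).1.rowLen r) := by
    refine Finset.sum_nonneg fun r _ => ?_
    have := (hC.2.2 k r).1
    rw [hC.2.1 (k + 1) (by omega)] at this
    omega
  omega

lemma exists_sel {n N : ℕ} {lam mu : Sub n} {C : ℕ → Sub n} (hC : C ∈ Ch n N lam mu)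
    (h : ¬ ∀ i k, ¬ Fail C i k) : ∃ p : ℕ × ℕ, Sel C p.1 p.2 := by
  push Not at h
  have hi : ∃ i, ∃ k, Fail C i k := h
  obtain ⟨k0, hk0⟩ := Nat.find_spec hi
  refine ⟨(Nat.find hi, Nat.findGreatest (fun k => Fail C (Nat.find hi) k) N), ?_, ?_, ?_⟩
  · exact Nat.findGreatest_spec (P := fun k => Fail C (Nat.find hi) k)
      (show k0 ≤ N by have := fail_lt hC hk0; omega) hk0
  · intro i' hi' k' hf
    exact Nat.find_min hi hi' ⟨k', hf⟩
  · intro k' hk' hf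
    have := fail_lt hC hf
    exact Nat.findGreatest_is_greatest hk' (by omega) hf

/-- The sign reversing operation. -/
noncomputable def star {n : ℕ} (C : ℕ → Sub n) (i k : ℕ) : ℕ → Sub n :=
  Function.update C (k + 1) (togD (C (k + 2)) (C k) (C (k + 1)) i (Jz C i k).toNat)

lemma sel_bounds {n N : ℕ} {lam mu : Sub n} {C : ℕ → Sub n} (hC : C ∈ Ch n N lam mu) {i k : ℕ}
    (h : Sel C i k) : ((Jz C i k).toNat : ℤ) = Jz C i k ∧
    (Jz C i k).toNat ≤ (C (k + 2)).1.rowLen i ∧ (C (k + 1)).1.rowLen i ≤ (Jz C i k).toNat ∧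
    (∀ i', i = i' + 1 → (Jz C i k).toNat ≤ (C k).1.rowLen i') := by
  have h1 := (fail_iff C i k).1 h.1
  have h0 : ((Jz C i k).toNat : ℤ) = Jz C i k := Int.toNat_of_nonneg (by omega)
  have hC' := mem_Ch.1 hC
  refine ⟨h0, ?_, by omega, ?_⟩
  · cases i with
    | zero =>
      have : Jz C 0 k = (C (k + 2)).1.rowLen 0 - 1 := by simp [Jz]
      omega
    | succ i =>
      have h2 := h.2.1 i (by omega) k
      have h3 := (hC'.2.2 k i).1
      rw [Fail, Finset.sum_range_succ] at h2
      have h4 := Jz_def C (i + 1) k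
      rw [Finset.sum_range_succ] at h4
      simp only [Finset.sum_sub_distrib, ← Finset.mul_sum] at h2 h4
      omega
  · rintro i rfl
    have h2 := h.2.1 i (by omega) k
    have h3 := (hC'.2.2 (k + 1) i).2
    rw [Fail, Finset.sum_range_succ] at h2
    have h4 := Jz_def C (i + 1) k
    rw [Finset.sum_range_succ] at h4
    simp only [Finset.sum_sub_distrib, ← Finset.mul_sum] at h2 h4
    simp only [add_assoc, Nat.reduceAdd] at h3
    omega

lemma star_spec {n N : ℕ} {lam mu : Sub n} {C : ℕ → Sub n} (hC : C ∈ Ch n N lam mu) {i k : ℕ}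
    (h : Sel C i k) : star C i k ∈ Ch n N lam mu ∧ Sel (star C i k) i k ∧
      star (star C i k) i k = C ∧
      ((star C i k (k + 1)).1.card : ℤ) + (C (k + 1)).1.card =
        (C (k + 2)).1.card + (C k).1.card - 1 := by
  obtain ⟨b0, b1, b2, b3⟩ := sel_bounds hC h
  have hC' := mem_Ch.1 hC
  have hs1 := hC'.2.2 (k + 1)
  have hs2 := hC'.2.2 k
  have hlt := fail_lt hC h.1
  obtain ⟨t1, t2, t3, t4, t5⟩ := togD_spec hs1 hs2 b1 b2 b3
  have tc := togD_card hs1 hs2 b1 b2 b3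
  have e1 : star C i k (k + 1) =
      togD (C (k + 2)) (C k) (C (k + 1)) i (Jz C i k).toNat := by simp [star]
  have e2 : ∀ j, j ≠ k + 1 → star C i k j = C j := fun j hj => by simp [star, hj]
  have e3 : ∀ j r, r < i → (star C i k j).1.rowLen r = (C j).1.rowLen r := by
    intro j r hr
    by_cases hj : j = k + 1
    · subst hj
      rw [e1]
      exact t4 r hr
    · rw [e2 j hj]
  have eJ : Jz (star C i k) i k = Jz C i k := by
    rw [Jz, Jz, e2 (k + 2) (by omega)]
    congr 1
    refine Finset.sum_congr rfl fun r hr => ?_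
    rw [Finset.mem_range] at hr
    rw [e3 _ _ hr, e2 k (by omega)]
  refine ⟨?_, ⟨?_, ?_, ?_⟩, ?_, ?_⟩
  · rw [mem_Ch]
    refine ⟨?_, ?_, ?_⟩
    · rw [e2 _ (by omega)]; exact hC'.1
    · intro j hj
      rw [e2 _ (by omega)]; exact hC'.2.1 j hj
    · intro j
      by_cases hj : j = k + 1
      · subst hj
        rw [e1, e2 _ (by omega)]
        exact t1
      · by_cases hj' : j = k
        · subst hj'
          rw [e1, e2 _ (by omega)]
          exact t2
        · rw [e2 _ (by omega), e2 _ (by omega)]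
          exact hC'.2.2 j
  · rw [fail_iff, eJ, e1, ← b0]
    exact_mod_cast t3
  · intro i' hi' k'
    have : Fail (star C i k) i' k' ↔ Fail C i' k' := by
      have a1 : ∑ r ∈ Finset.range i', (((star C i k (k' + 1)).1.rowLen r : ℤ) -
          (star C i k k').1.rowLen r) = ∑ r ∈ Finset.range i', (((C (k' + 1)).1.rowLen r : ℤ) -
          (C k').1.rowLen r) := Finset.sum_congr rfl fun r hr => by
        rw [Finset.mem_range] at hr
        rw [e3 _ _ (by omega), e3 _ _ (by omega)]
      have a2 : ∑ r ∈ Finset.range (i' + 1), (((star C i k (k' + 2)).1.rowLen r : ℤ) -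
          (star C i k (k' + 1)).1.rowLen r) = ∑ r ∈ Finset.range (i' + 1),
          (((C (k' + 2)).1.rowLen r : ℤ) - (C (k' + 1)).1.rowLen r) :=
        Finset.sum_congr rfl fun r hr => by
          rw [Finset.mem_range] at hr
          rw [e3 _ _ (by omega), e3 _ _ (by omega)]
      rw [Fail, Fail, a1, a2]
    rw [this]
    exact h.2.1 i' hi' k'
  · intro k' hk'
    have : Fail (star C i k) i k' ↔ Fail C i k' := by
      have a1 : ∑ r ∈ Finset.range i, (((star C i k (k' + 1)).1.rowLen r : ℤ) -
          (star C i k k').1.rowLen r) = ∑ r ∈ Finset.range i, (((C (k' + 1)).1.rowLen r : ℤ) -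
          (C k').1.rowLen r) := Finset.sum_congr rfl fun r hr => by
        rw [Finset.mem_range] at hr
        rw [e3 _ _ (by omega), e3 _ _ (by omega)]
      rw [Fail, Fail, a1, e2 (k' + 2) (by omega), e2 (k' + 1) (by omega)]
    rw [this]
    exact h.2.2 k' hk'
  · have : star (star C i k) i k (k + 1) = C (k + 1) := by
      rw [star, eJ, Function.update_self, e2 (k + 2) (by omega), e2 k (by omega), e1]
      exact t5
    funext j
    by_cases hj : j = k + 1
    · subst hj; exact this
    · rw [star, Function.update_of_ne hj, e2 _ hj]
  · rw [e1, tc, b0, Jz]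
    ring

/-- The alternating functional extracting a Littlewood-Richardson coefficient. -/
noncomputable def gdet (N : ℕ) (nu : ℕ → ℕ) (a : ℕ →₀ ℕ) : ℤ :=
  Matrix.det (Matrix.of fun i j : Fin N =>
    if ((a i : ℤ) - (i : ℕ) = (nu j : ℤ) - (j : ℕ)) then (1 : ℤ) else 0)

lemma gdet_swap {N : ℕ} (nu : ℕ → ℕ) (a b : ℕ →₀ ℕ) (k : ℕ) (hk : k + 1 < N)
    (h1 : (b k : ℤ) = a (k + 1) - 1) (h2 : (b (k + 1) : ℤ) = a k + 1)
    (h3 : ∀ j, j < N → j ≠ k → j ≠ k + 1 → b j = a j) : gdet N nu b = - gdet N nu a := by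
  have hne : (⟨k, by omega⟩ : Fin N) ≠ ⟨k + 1, hk⟩ := by
    intro h; simp at h
  have : (Matrix.of fun i j : Fin N =>
      if ((b i : ℤ) - (i : ℕ) = (nu j : ℤ) - (j : ℕ)) then (1 : ℤ) else 0) =
      (Matrix.of fun i j : Fin N =>
      if ((a i : ℤ) - (i : ℕ) = (nu j : ℤ) - (j : ℕ)) then (1 : ℤ) else 0).submatrix
      (Equiv.swap ⟨k, by omega⟩ ⟨k + 1, hk⟩) id := by
    ext i j
    simp only [Matrix.of_apply, Matrix.submatrix_apply, id]
    have : (b i : ℤ) - (i : ℕ) =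
      (a (Equiv.swap (⟨k, by omega⟩ : Fin N) ⟨k + 1, hk⟩ i : Fin N) : ℤ) -
        ((Equiv.swap (⟨k, by omega⟩ : Fin N) ⟨k + 1, hk⟩ i : Fin N) : ℕ) := by
      by_cases e1 : i = ⟨k, by omega⟩
      · rw [e1, Equiv.swap_apply_left]
        simp only
        push_cast
        omega
      · by_cases e2 : i = ⟨k + 1, hk⟩
        · rw [e2, Equiv.swap_apply_right]
          simp only
          push_cast
          omega
        · rw [Equiv.swap_apply_of_ne_of_ne e1 e2, h3 i i.2]
          · intro h; exact e1 (Fin.ext h)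
          · intro h; exact e2 (Fin.ext h)
    rw [this]
  rw [gdet, this, Matrix.det_permute, Equiv.Perm.sign_swap hne, gdet]
  simp

lemma gdet_dec {N : ℕ} (nu : ℕ → ℕ) (hnu : Antitone nu) (a : ℕ →₀ ℕ)
    (ha : ∀ k, k + 1 < N → a (k + 1) ≤ a k) :
    gdet N nu a = if (∀ k, k < N → a k = nu k) then 1 else 0 := by
  have ha' : ∀ i j, i ≤ j → j < N → a j ≤ a i := by
    intro i j hij
    induction j, hij using Nat.le_induction with
    | base => intro _; exact le_rfl
    | succ j hj ih => intro h; exact (ha j h).trans (ih (by omega))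
  have inj : ∀ i j : Fin N, ((nu i : ℤ) - (i : ℕ) = (nu j : ℤ) - (j : ℕ)) ↔ i = j := by
    intro i j
    constructor
    · intro h
      rcases lt_trichotomy i j with g | g | g
      · have := hnu (show (i : ℕ) ≤ j from g.le)
        have g' : (i : ℕ) < j := g
        omega
      · exact g
      · have := hnu (show (j : ℕ) ≤ i from g.le)
        have g' : (j : ℕ) < i := g
        omega
    · rintro rfl; rfl
  split_ifs with h
  · have : (Matrix.of fun i j : Fin N =>
      if ((a i : ℤ) - (i : ℕ) = (nu j : ℤ) - (j : ℕ)) then (1 : ℤ) else 0) = 1 := by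
      ext i j
      rw [Matrix.of_apply, h i i.2, Matrix.one_apply]
      simp only [inj]
    rw [gdet, this, Matrix.det_one]
  · rw [gdet, Matrix.det_apply]
    apply Finset.sum_eq_zero
    intro w _
    by_contra hc
    apply h
    have hw : ∀ i : Fin N, ((a (w i) : ℤ) - (w i : ℕ) = (nu i : ℤ) - (i : ℕ)) := by
      intro i
      by_contra hi
      apply hc
      rw [Finset.prod_eq_zero (Finset.mem_univ i), smul_zero]
      rw [Matrix.of_apply, if_neg hi]
    have mono : StrictMono w := by
      intro i j hij
      by_contra hle
      push Not at hle
      have h1 := ha' (w j) (w i) hle (w i).2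
      have h2 := hnu (show (i : ℕ) ≤ j from hij.le)
      have h3 := hw i
      have h4 := hw j
      have h5 : (i : ℕ) < j := hij
      have h6 : ((w j : Fin N) : ℕ) ≤ w i := hle
      omega
    have hid : ∀ i, w i = i := by
      have : (w : Fin N → Fin N) = id :=
        (StrictMono.range_inj mono strictMono_id).1 (by simp [w.surjective.range_eq])
      intro i; rw [this]; rfl
    intro k hk
    have := hw ⟨k, hk⟩
    rw [hid] at this
    simp only at this
    omega

/-- Littlewood-Richardson chains. -/
noncomputable def LRCh (n N : ℕ) (mu : Sub n) (nu : ℕ → ℕ) : Finset (ℕ → Sub n) :=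
  (Ch n N (top n) mu).filter fun C => (∀ i k, ¬ Fail C i k) ∧ ∀ k, k < N → cc C k = nu k

lemma cc_cast {n N : ℕ} {lam mu : Sub n} {C : ℕ → Sub n} (hC : C ∈ Ch n N lam mu) (k : ℕ) :
    (cc C k : ℤ) = (C (k + 1)).1.card - (C k).1.card := by
  have := ((mem_Ch.1 hC).2.2 k).card_le
  rw [cc]
  omega

lemma nofail_dec {n N : ℕ} {lam mu : Sub n} {C : ℕ → Sub n} (hC : C ∈ Ch n N lam mu)
    (h : ∀ i k, ¬ Fail C i k) (k : ℕ) : cc C (k + 1) ≤ cc C k := by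
  have h1 := h n k
  rw [Fail] at h1
  have a := cc_cast hC k
  have b := cc_cast hC (k + 1)
  simp only [add_assoc, Nat.reduceAdd] at b
  rw [card_eq_sum' (C (k + 2)) (n + 1) (by omega), card_eq_sum' (C (k + 1)) (n + 1) (by omega)] at b
  rw [card_eq_sum' (C (k + 1)) n (by omega), card_eq_sum' (C k) n (by omega)] at a
  push_cast at a b
  simp only [Finset.sum_sub_distrib] at h1
  omega

lemma LRCh_card {n N : ℕ} (mu : Sub n) (nu : ℕ → ℕ) (hnu : Antitone nu) :
    ((LRCh n N mu nu).card : ℤ) = ∑ C ∈ Ch n N (top n) mu, gdet N nu (cont N C) := by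
  rw [← Finset.sum_filter_add_sum_filter_not (Ch n N (top n) mu) (fun C => ∀ i k, ¬ Fail C i k)]
  have bad : ∑ C ∈ (Ch n N (top n) mu).filter (fun C => ¬ ∀ i k, ¬ Fail C i k),
      gdet N nu (cont N C) = 0 := by
    have hex : ∀ C, C ∈ (Ch n N (top n) mu).filter (fun C => ¬ ∀ i k, ¬ Fail C i k) →
        C ∈ Ch n N (top n) mu ∧ ∃ p : ℕ × ℕ, Sel C p.1 p.2 := by
      intro C hC
      rw [Finset.mem_filter] at hC
      exact ⟨hC.1, exists_sel hC.1 hC.2⟩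
    have hneg : ∀ C, C ∈ Ch n N (top n) mu → ∀ i k, Sel C i k →
        gdet N nu (cont N (star C i k)) = - gdet N nu (cont N C) := by
      intro C hC i k hs
      obtain ⟨s1, -, -, s4⟩ := star_spec hC hs
      have hlt := fail_lt hC hs.1
      have e2 : ∀ j, j ≠ k + 1 → star C i k j = C j := fun j hj => by simp [star, hj]
      refine gdet_swap nu _ _ k hlt ?_ ?_ ?_
      · rw [cont_apply _ (by omega), cont_apply _ (by omega), cc_cast s1, cc_cast hC,
          e2 k (by omega)]
        simp only [add_assoc, Nat.reduceAdd]
        omega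
      · rw [cont_apply _ (by omega), cont_apply _ (by omega), cc_cast s1, cc_cast hC]
        simp only [add_assoc, Nat.reduceAdd]
        rw [e2 (k + 2) (by omega)]
        omega
      · intro j hj h1 h2
        rw [cont_apply _ hj, cont_apply _ hj, cc, cc, e2 _ (by omega), e2 _ (by omega)]
    refine Finset.sum_involution
      (fun C hC => star C (hex C hC).2.choose.1 (hex C hC).2.choose.2) ?_ ?_ ?_ ?_
    · intro C hC
      rw [hneg C (hex C hC).1 _ _ (hex C hC).2.choose_spec]
      ring
    · intro C hC hne he
      have := hneg C (hex C hC).1 _ _ (hex C hC).2.choose_spec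
      rw [he] at this
      omega
    · intro C hC
      obtain ⟨s1, s2, -, -⟩ := star_spec (hex C hC).1 (hex C hC).2.choose_spec
      rw [Finset.mem_filter]
      exact ⟨s1, fun h => h _ _ s2.1⟩
    · intro C hC
      obtain ⟨s1, s2, s3, -⟩ := star_spec (hex C hC).1 (hex C hC).2.choose_spec
      generalize_proofs p1 p2
      have q := p2.choose_spec.unique s2
      rw [q.1, q.2]
      exact s3
  rw [bad, add_zero, LRCh, ← Finset.filter_filter, Finset.card_filter]
  push_cast
  refine Finset.sum_congr rfl fun C hC => ?_
  rw [Finset.mem_filter] at hC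
  rw [gdet_dec nu hnu]
  · congr 1
    refine propext (forall_congr' fun k => forall_congr' fun hk => ?_)
    rw [cont_apply _ hk]
  · intro k hk
    rw [cont_apply _ (by omega), cont_apply _ (by omega)]
    exact nofail_dec hC.1 hC.2 k

lemma LRCh_tr {n N : ℕ} (mu : Sub n) (nu : ℕ → ℕ) (hnu : Antitone nu) :
    (LRCh n N (tr n mu) nu).card = (LRCh n N mu nu).card := by
  have h1 := LRCh_card (N := N) (tr n mu) nu hnu
  have h2 := LRCh_card (N := N) mu nu hnu
  rw [sum_tr, ← h2] at h1
  exact_mod_cast h1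

/-- The filling `T` corresponds to the chain `C`. -/
def Rel {n : ℕ} (T : ℕ × ℕ → ℕ) (C : ℕ → Sub n) : Prop :=
  (∀ p, p ∉ staircase n → T p = 0) ∧ ∀ p ∈ staircase n, ∀ k, p ∈ (C k).1 ↔ T p ≤ k

/-- The filling of a chain. -/
noncomputable def fil {n : ℕ} (C : ℕ → Sub n) (p : ℕ × ℕ) : ℕ := sInf {k | p ∈ (C k).1}

lemma Ch_mono {n N : ℕ} {mu : Sub n} {C : ℕ → Sub n} (hC : C ∈ Ch n N (top n) mu) :
    Monotone C := by
  rw [mem_Ch] at hC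
  exact monotone_nat_of_le_succ fun k => ((HS_iff _ _).1 (hC.2.2 k)).1

lemma rel_fil {n N : ℕ} {mu : Sub n} {C : ℕ → Sub n} (hC : C ∈ Ch n N (top n) mu) :
    Rel (fil C) C := by
  have hm := Ch_mono hC
  rw [mem_Ch] at hC
  refine ⟨fun p hp => ?_, fun p hp k => ⟨fun h => Nat.sInf_le h, fun h => ?_⟩⟩
  · have : {k | p ∈ (C k).1} = ∅ := by
      ext k
      simp only [Set.mem_setOf_eq, Set.mem_empty_iff_false, iff_false]
      exact fun h => hp ((C k).2 h)
    rw [fil, this, Nat.sInf_empty]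
  · have hne : {k | p ∈ (C k).1}.Nonempty := ⟨N, by
      change p ∈ (C N).1
      rw [hC.2.1 N le_rfl]; exact hp⟩
    exact hm h (Nat.sInf_mem hne)

lemma rel_unique {n : ℕ} {T : ℕ × ℕ → ℕ} {C C' : ℕ → Sub n} (h : Rel T C) (h' : Rel T C') :
    C = C' := by
  funext k
  apply Subtype.ext
  ext p
  rw [mem_cells, mem_cells]
  by_cases hp : p ∈ staircase n
  · rw [h.2 p hp, h'.2 p hp]
  · exact iff_of_false (fun hh => hp ((C k).2 hh)) (fun hh => hp ((C' k).2 hh))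

lemma rel_unique_T {n : ℕ} {T T' : ℕ × ℕ → ℕ} {C : ℕ → Sub n} (h : Rel T C) (h' : Rel T' C) :
    T = T' := by
  funext p
  by_cases hp : p ∈ staircase n
  · exact le_antisymm ((h.2 p hp _).1 ((h'.2 p hp _).2 le_rfl))
      ((h'.2 p hp _).1 ((h.2 p hp _).2 le_rfl))
  · rw [h.1 p hp, h'.1 p hp]

section
variable {n N : ℕ} {mu : Sub n} {C : ℕ → Sub n} {T : ℕ × ℕ → ℕ}

lemma rel_skew (hC : C ∈ Ch n N (top n) mu) (h : Rel T C) (p : ℕ × ℕ) :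
    p ∈ skewCells (staircase n) mu.1 ↔ T p ≠ 0 := by
  rw [skewCells, Finset.mem_sdiff, mem_cells, mem_cells]
  rw [mem_Ch] at hC
  by_cases hp : p ∈ staircase n
  · have := h.2 p hp 0
    rw [hC.1] at this
    rw [this]
    simp [hp]
  · simp [hp, h.1 p hp]

lemma rel_step (h : Rel T C) (k : ℕ) (p : ℕ × ℕ) :
    T p = k + 1 ↔ p ∈ (C (k + 1)).1.cells \ (C k).1.cells := by
  rw [Finset.mem_sdiff, mem_cells, mem_cells]
  by_cases hp : p ∈ staircase n
  · rw [h.2 p hp, h.2 p hp]; omega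
  · rw [h.1 p hp]
    exact iff_of_false (by omega) (fun hh => hp ((C _).2 hh.1))

lemma rel_filter (hC : C ∈ Ch n N (top n) mu) (h : Rel T C) (k : ℕ) (P : ℕ × ℕ → Prop) :
    ((skewCells (staircase n) mu.1).filter fun p => P p ∧ T p = k + 1) =
      ((C (k + 1)).1.cells \ (C k).1.cells).filter P := by
  ext p
  rw [Finset.mem_filter, Finset.mem_filter, rel_skew hC h, ← rel_step h]
  constructor
  · rintro ⟨-, h1, h2⟩; exact ⟨h2, h1⟩
  · rintro ⟨h2, h1⟩; exact ⟨by omega, h1, h2⟩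

lemma rel_content (hC : C ∈ Ch n N (top n) mu) (h : Rel T C) (k : ℕ) :
    content (staircase n) mu.1 T (k + 1) = cc C k := by
  have := rel_filter hC h k (fun _ => True)
  simp only [true_and, Finset.filter_true] at this
  rw [content, this, cc, YoungDiagram.card, YoungDiagram.card]
  exact Finset.card_sdiff_of_subset (Ch_mono hC (Nat.le_succ k))

lemma rows_count (hm : Monotone C) (i k : ℕ) :
    ((((C (k + 1)).1.cells \ (C k).1.cells).filter fun p => p.1 < i).card : ℤ) =
      ∑ r ∈ Finset.range i, (((C (k + 1)).1.rowLen r : ℤ) - (C k).1.rowLen r) := by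
  have hs : (C k).1.cells ⊆ (C (k + 1)).1.cells := hm (Nat.le_succ k)
  have e : (((C (k + 1)).1.cells \ (C k).1.cells).filter fun p => p.1 < i) =
      ((C (k + 1)).1.cells.filter fun p => p.1 < i) \ ((C k).1.cells.filter fun p => p.1 < i) := by
    ext p
    simp only [Finset.mem_filter, Finset.mem_sdiff]
    tauto
  rw [e, Finset.cast_card_sdiff (Finset.filter_subset_filter _ hs), card_rows, card_rows,
    Finset.sum_sub_distrib]
  push_cast
  rfl

lemma rel_lattice (hC : C ∈ Ch n N (top n) mu) (h : Rel T C) :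
    IsLattice (staircase n) mu.1 T ↔ ∀ i k, ¬ Fail C i k := by
  have hm := Ch_mono hC
  have hp : ∀ i j k, prefixCount (staircase n) mu.1 T i j (k + 1) =
      (((C (k + 1)).1.cells \ (C k).1.cells).filter
        fun p => p.1 < i ∨ (p.1 = i ∧ j ≤ p.2)).card := fun i j k => by
    have := congrArg Finset.card (rel_filter hC h k fun p => p.1 < i ∨ (p.1 = i ∧ j ≤ p.2))
    rw [prefixCount]
    convert this
  constructor
  · intro hl i k
    rw [Fail, not_lt, ← rows_count hm, ← rows_count hm]
    have := hl i ((C (k + 1)).1.rowLen i) k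
    rw [hp, show k + 2 = (k + 1) + 1 from rfl, hp] at this
    norm_cast
    refine le_trans (Finset.card_le_card ?_) (this.trans (Finset.card_le_card ?_))
    · rintro ⟨a, b⟩ hab
      simp only [Finset.mem_filter, Finset.mem_sdiff, mem_cells] at hab ⊢
      refine ⟨hab.1, ?_⟩
      rcases Nat.lt_succ_iff_lt_or_eq.1 hab.2 with h1 | h1
      · exact Or.inl h1
      · subst h1
        refine Or.inr ⟨rfl, ?_⟩
        have := hab.1.2
        rw [YoungDiagram.mem_iff_lt_rowLen] at this
        omega
    · rintro ⟨a, b⟩ hab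
      simp only [Finset.mem_filter, Finset.mem_sdiff, mem_cells] at hab ⊢
      refine ⟨hab.1, ?_⟩
      rcases hab.2 with h1 | ⟨rfl, h1⟩
      · exact h1
      · have := hab.1.1
        rw [YoungDiagram.mem_iff_lt_rowLen] at this
        omega
  · intro hf i j k
    have := hf i k
    rw [Fail, not_lt, ← rows_count hm, ← rows_count hm] at this
    norm_cast at this
    rw [hp, show k + 2 = (k + 1) + 1 from rfl, hp]
    refine le_trans (Finset.card_le_card ?_) (this.trans (Finset.card_le_card ?_))
    · rintro ⟨a, b⟩ hab
      simp only [Finset.mem_filter, Finset.mem_sdiff, mem_cells] at hab ⊢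
      exact ⟨hab.1, by omega⟩
    · rintro ⟨a, b⟩ hab
      simp only [Finset.mem_filter, Finset.mem_sdiff, mem_cells] at hab ⊢
      exact ⟨hab.1, Or.inl hab.2⟩

lemma rel_ssyt (hC : C ∈ Ch n N (top n) mu) (h : Rel T C) : IsSSYT (staircase n) mu.1 T := by
  have hd : ∀ p, p ∈ skewCells (staircase n) mu.1 → p ∈ staircase n := fun p hp =>
    (Finset.mem_sdiff.1 hp).1
  refine ⟨rel_skew hC h, ?_, ?_⟩
  · intro i j1 j2 h1 h2 hj
    rw [← h.2 _ (hd _ h1)]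
    have := (h.2 _ (hd _ h2) _).2 le_rfl
    exact (C _).1.up_left_mem le_rfl hj this
  · intro i1 i2 j h1 h2 hi
    have h0 := (rel_skew hC h _).1 h2
    obtain ⟨t, ht⟩ := Nat.exists_eq_succ_of_ne_zero h0
    rw [ht, Nat.lt_succ_iff, ← h.2 _ (hd _ h1)]
    have h3 : (i2, j) ∈ (C (t + 1)).1 := (h.2 _ (hd _ h2) _).2 ht.le
    have h4 := ((HS_iff _ _).1 ((mem_Ch.1 hC).2.2 t)).2 i1 j
      ((C _).1.up_left_mem hi le_rfl h3)
    exact h4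

end

lemma exists_rel {n : ℕ} (mu : Sub n) (nu : YoungDiagram) {T : ℕ × ℕ → ℕ}
    (hT : IsLR (staircase n) mu.1 nu T) :
    ∃ C ∈ Ch n (nu.colLen 0) (top n) mu, Rel T C := by
  obtain ⟨⟨hs, hr, hc⟩, -, hn⟩ := hT
  have hsk : ∀ p, p ∈ skewCells (staircase n) mu.1 ↔ p ∈ staircase n ∧ p ∉ mu.1 := fun p => by
    rw [skewCells, Finset.mem_sdiff, mem_cells, mem_cells]
  have hmu : ∀ p ∈ mu.1, T p = 0 := fun p hp => by
    by_contra h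
    exact ((hsk p).1 ((hs p).2 h)).2 hp
  have hout : ∀ p, p ∉ staircase n → T p = 0 := fun p hp => by
    by_contra h
    exact hp ((hsk p).1 ((hs p).2 h)).1
  have hrow : ∀ i j1 j2, j1 ≤ j2 → (i, j2) ∈ staircase n → T (i, j1) ≤ T (i, j2) := by
    intro i j1 j2 hj h2
    by_cases h1 : T (i, j1) = 0
    · omega
    have h1' := (hs _).2 h1
    refine hr i j1 j2 h1' ((hsk _).2 ⟨h2, fun h => ((hsk _).1 h1').2 ?_⟩) hj
    exact mu.1.up_left_mem le_rfl hj h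
  have hcol : ∀ i1 i2 j, i1 < i2 → (i2, j) ∈ staircase n →
      T (i1, j) < T (i2, j) ∨ T (i2, j) = 0 := by
    intro i1 i2 j hi h2
    by_cases h3 : T (i2, j) = 0
    · exact Or.inr h3
    by_cases h1 : T (i1, j) = 0
    · omega
    exact Or.inl (hc _ _ _ ((hs _).2 h1) ((hs _).2 h3) hi)
  have hcol0 : ∀ i1 i2 j, i1 < i2 → (i2, j) ∈ staircase n → T (i2, j) = 0 → T (i1, j) = 0 := by
    intro i1 i2 j hi h2 h3
    by_contra h1
    have h2' : (i2, j) ∈ mu.1 := by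
      by_contra hh
      exact (hs _).1 ((hsk _).2 ⟨h2, hh⟩) h3
    exact ((hsk _).1 ((hs _).2 h1)).2 (mu.1.up_left_mem hi.le le_rfl h2')
  have hbd : ∀ p, T p ≤ nu.colLen 0 := by
    intro p
    by_contra hp
    obtain ⟨t, ht⟩ := Nat.exists_eq_succ_of_ne_zero (show T p ≠ 0 by omega)
    have h1 := hn t
    have h2 : nu.rowLen t = 0 := by
      by_contra h2
      have : (t, 0) ∈ nu := YoungDiagram.mem_iff_lt_rowLen.2 (by omega)
      rw [YoungDiagram.mem_iff_lt_colLen] at this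
      omega
    rw [h2, content, Finset.card_eq_zero] at h1
    have : p ∈ (skewCells (staircase n) mu.1).filter fun p => T p = t + 1 :=
      Finset.mem_filter.2 ⟨(hs p).2 (by omega), ht⟩
    rw [h1] at this
    simp at this
  let D : ℕ → YoungDiagram := fun k => ⟨(staircase n).cells.filter fun p => T p ≤ k, by
    rintro ⟨a1, a2⟩ ⟨b1, b2⟩ hba ha
    simp only [Finset.coe_filter, Set.mem_setOf_eq, mem_cells] at ha ⊢
    obtain ⟨h1, h2⟩ : b1 ≤ a1 ∧ b2 ≤ a2 := hba
    refine ⟨(staircase n).up_left_mem h1 h2 ha.1, ?_⟩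
    have h3 := hrow b1 b2 a2 h2 ((staircase n).up_left_mem h1 le_rfl ha.1)
    rcases h1.lt_or_eq with h4 | rfl
    · have h5 := hcol b1 a1 a2 h4 ha.1
      have h6 := hcol0 b1 a1 a2 h4 ha.1
      omega
    · omega⟩
  have hD : ∀ k p, p ∈ D k ↔ p ∈ staircase n ∧ T p ≤ k := fun k p => by
    rw [← mem_cells]
    simp only [D, Finset.mem_filter, mem_cells]
  refine ⟨fun k => ⟨D k, fun p hp => ((hD k p).1 hp).1⟩, mem_Ch.2 ⟨?_, ?_, ?_⟩, hout, ?_⟩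
  · apply Subtype.ext
    ext p
    rw [mem_cells, mem_cells, hD]
    constructor
    · rintro ⟨h1, h2⟩
      by_contra h3
      exact (hs p).1 ((hsk p).2 ⟨h1, h3⟩) (by omega)
    · intro h
      exact ⟨mu.2 h, (hmu p h).le⟩
  · intro k hk
    apply Subtype.ext
    ext p
    rw [mem_cells, mem_cells, hD]
    exact ⟨fun h => h.1, fun h => ⟨h, (hbd p).trans hk⟩⟩
  · intro k
    rw [HS_iff]
    refine ⟨fun p hp => ?_, fun i j hij => ?_⟩
    · have := (hD k p).1 hp
      exact (hD (k + 1) p).2 ⟨this.1, by omega⟩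
    · have h1 := (hD (k + 1) _).1 hij
      refine (hD k _).2 ⟨(staircase n).up_left_mem (Nat.le_succ i) le_rfl h1.1, ?_⟩
      have h5 := hcol i (i + 1) j (Nat.lt_succ_self i) h1.1
      have h6 := hcol0 i (i + 1) j (Nat.lt_succ_self i) h1.1
      omega
  · intro p hp k
    change p ∈ D k ↔ _
    rw [hD]
    simp [hp]

lemma ncard_LR {n : ℕ} (mu : Sub n) (nu : YoungDiagram) :
    {T : ℕ × ℕ → ℕ | IsLR (staircase n) mu.1 nu T}.ncard =
      (LRCh n (nu.colLen 0) mu nu.rowLen).card := by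
  have key : {T : ℕ × ℕ → ℕ | IsLR (staircase n) mu.1 nu T} =
      ((LRCh n (nu.colLen 0) mu nu.rowLen).image fil : Finset (ℕ × ℕ → ℕ)) := by
    ext T
    rw [Finset.coe_image, Set.mem_image]
    constructor
    · intro hT
      obtain ⟨C, hC, hR⟩ := exists_rel mu nu hT
      refine ⟨C, ?_, rel_unique_T (rel_fil hC) hR⟩
      rw [Finset.mem_coe, LRCh, Finset.mem_filter]
      exact ⟨hC, (rel_lattice hC hR).1 hT.2.1, fun k _ =>
        (rel_content hC hR k).symm.trans (hT.2.2 k)⟩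
    · rintro ⟨C, hC, rfl⟩
      rw [Finset.mem_coe, LRCh, Finset.mem_filter] at hC
      obtain ⟨hC, hl, hn⟩ := hC
      have hR := rel_fil hC
      refine ⟨rel_ssyt hC hR, (rel_lattice hC hR).2 hl, fun k => ?_⟩
      rw [rel_content hC hR]
      by_cases hk : k < nu.colLen 0
      · exact hn k hk
      · have h2 : nu.rowLen k = 0 := by
          by_contra h2
          have : (k, 0) ∈ nu := YoungDiagram.mem_iff_lt_rowLen.2 (by omega)
          rw [YoungDiagram.mem_iff_lt_colLen] at this
          omega
        have h3 := (mem_Ch.1 hC).2.1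
        rw [h2, cc, h3 k (by omega), h3 (k + 1) (by omega), Nat.sub_self]
  rw [key, Set.ncard_coe_finset, Finset.card_image_of_injOn]
  intro C hC C' hD hE
  rw [Finset.mem_coe, LRCh, Finset.mem_filter] at hC hD
  have h1 := rel_fil hC.1
  rw [hE] at h1
  exact rel_unique h1 (rel_fil hD.1)

/-- for the staircase partition `lam = (l, l-1, …, 2, 1)` and `mu ⊆ lam`, the
skew Schur functions of `lam/mu` and of its conjugate `lam/mu'` coincide. -/
theorem staircase_conjugate_schurEq (n : ℕ) (mu : YoungDiagram)
    (hmu : mu ≤ staircase n) (nu : YoungDiagram) :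
    lrCoeff (staircase n) mu nu = lrCoeff (staircase n) mu.transpose nu := by
  have h1 := ncard_LR ⟨mu, hmu⟩ nu
  have h2 := ncard_LR (tr n ⟨mu, hmu⟩) nu
  have h3 := LRCh_tr (N := nu.colLen 0) (⟨mu, hmu⟩ : Sub n) nu.rowLen
    (fun a b hab => nu.rowLen_anti a b hab)
  have h4 : mu.transpose ≤ staircase n := (tr n ⟨mu, hmu⟩).2
  rw [lrCoeff, lrCoeff, if_pos hmu, if_pos h4]
  exact h1.trans (h3.symm.trans h2.symm)

end LRSkew
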